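/- Closeness of the constant mutual-information terms (Lemma on Ψ). With η_L = ρ, γ_L = ε, η_{L−1} = ρρ_L, γ_{L−1} = ρ²ε_L + ε, define for k ∈ {L−1, L}: Ψ_k := E log P_out( Y^{(k)} | η_k a^{*(k)⊤}X_1^{(k)}/√d_k + √γ_k ξ^{*(k)} ), where a^{*(k)} ∈ ℝ^{d_k} has i.i.d. N(0,1) entries, ξ^{*(k)} ~ N(0,1), and, conditionally, Y^{(k)} is drawn from P_out(·| η_k a^{*(k)⊤}X_1^{(k)}/√d_k + √γ_k ξ^{*(k)}). Then there exists a constant C > 0 (depending only on φ, f, ρ, ε, Δ, L) such that |Ψ_L − Ψ_{L−1}| ≤ C / √d_m, with d_m = min{d_0,…,d_L}. -/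

import Mathlib

open MeasureTheory ProbabilityTheory

noncomputable section

/-- Standard Gaussian measure on `ℝ`. -/
def stdG : Measure ℝ := gaussianReal 0 1

instance : IsProbabilityMeasure stdG := by unfold stdG; infer_instance

/-- Standard Gaussian measure on `Fin k → ℝ`. -/
def stdGPi (k : ℕ) : Measure (Fin k → ℝ) := Measure.pi fun _ => stdG

instance (k : ℕ) : IsProbabilityMeasure (stdGPi k) := by unfold stdGPi; infer_instance

/-- The space of weights of an `L`-hidden-layer network with widths `d 0, …, d L`. -/
abbrev Wspace (d : ℕ → ℕ) (L : ℕ) :=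
  (ℓ : Fin L) → Fin (d ((ℓ : ℕ) + 1)) → Fin (d (ℓ : ℕ)) → ℝ

/-- i.i.d. standard Gaussian measure on the weights. -/
def Wmeasure (d : ℕ → ℕ) (L : ℕ) : Measure (Wspace d L) :=
  Measure.pi fun ℓ => Measure.pi fun _ => stdGPi (d (ℓ : ℕ))

instance (d : ℕ → ℕ) (L : ℕ) : IsProbabilityMeasure (Wmeasure d L) := by
  unfold Wmeasure; infer_instance

/-- Extension of a finite collection of weight matrices to all layer indices (by zero). -/
def extW {d : ℕ → ℕ} {L : ℕ} (W : Wspace d L) (ℓ : ℕ) : Fin (d (ℓ + 1)) → Fin (d ℓ) → ℝ :=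
  if h : ℓ < L then W ⟨ℓ, h⟩ else 0

/-- Post-activations `X^{(ℓ)} = φ(W^{(ℓ)} X^{(ℓ-1)} / √d_{ℓ-1})`. -/
def feat (φ : ℝ → ℝ) (d : ℕ → ℕ) (W : (ℓ : ℕ) → Fin (d (ℓ + 1)) → Fin (d ℓ) → ℝ)
    (x0 : Fin (d 0) → ℝ) : (ℓ : ℕ) → Fin (d ℓ) → ℝ
  | 0 => x0
  | (ℓ + 1) => fun i => φ ((∑ j, W ℓ i j * feat φ d W x0 ℓ j) / Real.sqrt (d ℓ : ℝ))

/-- Output kernel `P_out(y | x)`. -/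
def Pout {p : ℕ} (PA : Measure (Fin p → ℝ)) (Δ : ℝ) (f : ℝ → (Fin p → ℝ) → ℝ)
    (y x : ℝ) : ℝ :=
  ∫ A, Real.exp (-(y - f x A) ^ 2 / (2 * Δ)) / Real.sqrt (2 * Real.pi * Δ) ∂PA

/-- The channel smeared with the extra Gaussian noise `√ε ξ`. -/
def PoutEps {p : ℕ} (PA : Measure (Fin p → ℝ)) (Δ : ℝ) (f : ℝ → (Fin p → ℝ) → ℝ)
    (ε y s : ℝ) : ℝ :=
  ∫ ξ, Pout PA Δ f y (s + Real.sqrt ε * ξ) ∂stdG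

/-- The coefficients `σ_ℓ`. -/
def sigmaC (φ : ℝ → ℝ) : ℕ → ℝ
  | 0 => 1
  | (ℓ + 1) => ∫ z, (φ (z * Real.sqrt (sigmaC φ ℓ))) ^ 2 ∂stdG

/-- The coefficients `ρ_ℓ` (meaningful for `ℓ ≥ 1`). -/
def rhoC (φ : ℝ → ℝ) (ℓ : ℕ) : ℝ :=
  ∫ z, deriv φ (z * Real.sqrt (sigmaC φ (ℓ - 1))) ∂stdG

/-- The coefficients `ε_ℓ = σ_ℓ - σ_{ℓ-1} ρ_ℓ²` (meaningful for `ℓ ≥ 1`). -/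
def epsC (φ : ℝ → ℝ) (ℓ : ℕ) : ℝ :=
  sigmaC φ ℓ - sigmaC φ (ℓ - 1) * (rhoC φ ℓ) ^ 2

/-- `d_m = min{d_0, …, d_L}`. -/
def dmin (d : ℕ → ℕ) (L : ℕ) : ℕ :=
  (Finset.range (L + 1)).inf' (Finset.nonempty_range_iff.mpr (Nat.succ_ne_zero L)) d

/-- Linear readout of the `L`-layer network: `a⊤ X^{(L)} / √d_L`. -/
def netOut (φ : ℝ → ℝ) (d : ℕ → ℕ) (L : ℕ) (W : Wspace d L) (a : Fin (d L) → ℝ)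
    (x0 : Fin (d 0) → ℝ) : ℝ :=
  (∑ i, a i * feat φ d (extW W) x0 L i) / Real.sqrt (d L : ℝ)

/-- Partition function (normalisation of the Bayes posterior) of the `L`-layer model. -/
def partFun (L p : ℕ) (PA : Measure (Fin p → ℝ)) [IsProbabilityMeasure PA]
    (Δ ρ ε : ℝ) (φ : ℝ → ℝ) (f : ℝ → (Fin p → ℝ) → ℝ) (d : ℕ → ℕ) (n : ℕ)
    (X : Fin n → Fin (d 0) → ℝ) (Y : Fin n → ℝ) : ℝ :=
  ∫ θ : Wspace d L × (Fin (d L) → ℝ),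
      ∏ μ, PoutEps PA Δ f ε (Y μ) (ρ * netOut φ d L θ.1 θ.2 (X μ))
    ∂((Wmeasure d L).prod (stdGPi (d L)))

/-- Space of all the quenched randomness of the `L`-layer teacher model:
inputs, teacher weights, readout, output noises `ξ*`, label noises `Z` and channel
randomness `A`. -/
abbrev Dspace (d : ℕ → ℕ) (L p n : ℕ) :=
  (Fin n → Fin (d 0) → ℝ) × Wspace d L × (Fin (d L) → ℝ) ×
    (Fin n → ℝ) × (Fin n → ℝ) × (Fin n → Fin p → ℝ)

/-- Law of the quenched randomness. -/
def Dmeasure (d : ℕ → ℕ) (L p n : ℕ) (PA : Measure (Fin p → ℝ))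
    [IsProbabilityMeasure PA] : Measure (Dspace d L p n) :=
  (Measure.pi fun _ : Fin n => stdGPi (d 0)).prod
    ((Wmeasure d L).prod ((stdGPi (d L)).prod
      ((stdGPi n).prod ((stdGPi n).prod (Measure.pi fun _ : Fin n => PA)))))

/-- Teacher pre-readout signal `S_μ = ρ a*⊤X_μ^{(L)}/√d_L + √ε ξ*_μ`. -/
def Ssig (φ : ℝ → ℝ) (d : ℕ → ℕ) (L p n : ℕ) (ρ ε : ℝ) (ω : Dspace d L p n)
    (μi : Fin n) : ℝ :=
  ρ * netOut φ d L ω.2.1 ω.2.2.1 (ω.1 μi) + Real.sqrt ε * ω.2.2.2.1 μi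

/-- Teacher responses `Y_μ = f(S_μ; A_μ) + √Δ Z_μ`. -/
def Yresp (φ : ℝ → ℝ) (f : ℝ → (Fin p → ℝ) → ℝ) (d : ℕ → ℕ) (L n : ℕ)
    (ρ ε Δ : ℝ) (ω : Dspace d L p n) (μi : Fin n) : ℝ :=
  f (Ssig φ d L p n ρ ε ω μi) (ω.2.2.2.2.2 μi) + Real.sqrt Δ * ω.2.2.2.2.1 μi

/-- Mutual information per sample
`(1/n) I_n = E log P_out(Y_1|S_1) - (1/n) E log Z_L(D_L)`
(the first term is written as an average over samples, all equal by symmetry). -/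
def MIper (L p : ℕ) (PA : Measure (Fin p → ℝ)) [IsProbabilityMeasure PA]
    (Δ ρ ε : ℝ) (φ : ℝ → ℝ) (f : ℝ → (Fin p → ℝ) → ℝ) (d : ℕ → ℕ) (n : ℕ) : ℝ :=
  (1 / (n : ℝ)) * ∑ μi : Fin n,
      ∫ ω, Real.log (Pout PA Δ f (Yresp φ f d L n ρ ε Δ ω μi) (Ssig φ d L p n ρ ε ω μi))
        ∂(Dmeasure d L p n PA)
    - (1 / (n : ℝ)) *
      ∫ ω, Real.log (partFun L p PA Δ ρ ε φ f d n ω.1 (Yresp φ f d L n ρ ε Δ ω))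
        ∂(Dmeasure d L p n PA)


/-- The constant term `Ψ_k = E log P_out(Y^{(k)} | η_k a^{(k)}⊤X^{(k)}/√d_k + √γ_k ξ^{(k)})`
of the mutual information, for the reduced model with `k` hidden layers and channel
parameters `(η, γ)`. -/
def PsiK (L p : ℕ) (PA : Measure (Fin p → ℝ)) [IsProbabilityMeasure PA]
    (Δ : ℝ) (φ : ℝ → ℝ) (f : ℝ → (Fin p → ℝ) → ℝ) (d : ℕ → ℕ)
    (k : ℕ) (η γ : ℝ) : ℝ :=
  ∫ ω : (Fin (d 0) → ℝ) × Wspace d L × (Fin (d k) → ℝ) × ℝ × (Fin p → ℝ) × ℝ,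
      Real.log (Pout PA Δ f
        (f (η * ((∑ i, ω.2.2.1 i * feat φ d (extW ω.2.1) ω.1 k i) /
              Real.sqrt (d k : ℝ)) + Real.sqrt γ * ω.2.2.2.1) ω.2.2.2.2.1 +
          Real.sqrt Δ * ω.2.2.2.2.2)
        (η * ((∑ i, ω.2.2.1 i * feat φ d (extW ω.2.1) ω.1 k i) /
            Real.sqrt (d k : ℝ)) + Real.sqrt γ * ω.2.2.2.1))
    ∂((stdGPi (d 0)).prod ((Wmeasure d L).prod ((stdGPi (d k)).prod
        (stdG.prod (PA.prod stdG)))))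

lemma stdG_map_const_mul (c : ℝ) :
    stdG.map (fun g => c * g) = gaussianReal 0 (Real.toNNReal (c ^ 2)) := by
  rw [stdG, gaussianReal_map_const_mul]
  congr 1
  · simp
  · rw [mul_one]; exact (Real.toNNReal_of_nonneg _).symm

/-- A linear combination of independent standard Gaussians is Gaussian. -/
lemma stdGPi_map_sum_mul {n : ℕ} (x : Fin n → ℝ) :
    (stdGPi n).map (fun a => ∑ j, a j * x j) =
      gaussianReal 0 (Real.toNNReal (∑ j, x j ^ 2)) := by
  have h := iIndepFun_pi (μ := fun _ : Fin n => stdG) (X := fun j (g : ℝ) => g * x j)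
    (fun j => by fun_prop)
  apply Measure.ext_of_charFun
  have h2 := h.charFun_map_fun_sum_eq_prod
    (fun j => Measurable.aemeasurable (by fun_prop))
  ext t
  have e : ∀ j, (Measure.pi fun _ : Fin n => stdG).map (fun a => a j * x j) =
      gaussianReal 0 (Real.toNNReal (x j ^ 2)) := by
    intro j
    have h3 : (fun a : Fin n → ℝ => a j * x j) = (fun g => x j * g) ∘ (fun a => a j) := by
      ext a; simp [mul_comm]
    rw [h3, ← Measure.map_map (by fun_prop) (by fun_prop), (measurePreserving_eval _ j).map_eq,
      stdG_map_const_mul]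
  rw [stdGPi]
  refine (congrFun h2 t).trans ?_
  rw [Finset.prod_apply]
  simp_rw [e, charFun_gaussianReal]
  rw [← Complex.exp_sum]
  congr 1
  have hx : ∀ j, (0 : ℝ) ≤ x j ^ 2 := fun j => sq_nonneg _
  have hs : (0 : ℝ) ≤ ∑ j, x j ^ 2 := Finset.sum_nonneg fun j _ => hx j
  simp only [Real.coe_toNNReal _ (hx _), Real.coe_toNNReal _ hs]
  push_cast
  simp [Finset.sum_mul, Finset.sum_div]

/-- Empirical second moment of a vector. -/
def meanSq {n : ℕ} (x : Fin n → ℝ) : ℝ := (∑ j, x j ^ 2) / n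

lemma meanSq_nonneg {n : ℕ} (x : Fin n → ℝ) : 0 ≤ meanSq x :=
  div_nonneg (Finset.sum_nonneg fun _ _ => sq_nonneg _) (Nat.cast_nonneg _)

lemma stdGPi_map_mul_dot {n : ℕ} (x : Fin n → ℝ) (η : ℝ) :
    (stdGPi n).map (fun a => η * ((∑ j, a j * x j) / Real.sqrt (n : ℝ))) =
      gaussianReal 0 (Real.toNNReal (η ^ 2 * meanSq x)) := by
  have h : (fun a : Fin n → ℝ => η * ((∑ j, a j * x j) / Real.sqrt (n : ℝ))) =
      fun a => ∑ j, a j * (η * x j / Real.sqrt n) := by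
    ext a
    rw [Finset.sum_div, Finset.mul_sum]
    exact Finset.sum_congr rfl fun j _ => by ring
  rw [h, stdGPi_map_sum_mul]
  congr 2
  rw [meanSq, Finset.sum_div, Finset.mul_sum]
  refine Finset.sum_congr rfl fun j _ => ?_
  rw [div_pow, Real.sq_sqrt (Nat.cast_nonneg _)]
  ring

lemma stdGPi_map_dot {n : ℕ} (x : Fin n → ℝ) :
    (stdGPi n).map (fun a => (∑ j, a j * x j) / Real.sqrt (n : ℝ)) =
      stdG.map (fun g => Real.sqrt (meanSq x) * g) := by
  have := stdGPi_map_mul_dot x 1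
  simp only [one_mul, one_pow] at this
  rw [this, stdG_map_const_mul, Real.sq_sqrt (meanSq_nonneg x)]

/-- The pre-channel signal has the law of a centred Gaussian of variance `η² |x|²/n + γ`. -/
lemma signal_map {n : ℕ} (x : Fin n → ℝ) (η γ : ℝ) (hγ : 0 ≤ γ) :
    ((stdGPi n).prod stdG).map
        (fun q => η * ((∑ j, q.1 j * x j) / Real.sqrt (n : ℝ)) + Real.sqrt γ * q.2) =
      stdG.map (fun g => Real.sqrt (η ^ 2 * meanSq x + γ) * g) := by
  have h1 : (fun q : (Fin n → ℝ) × ℝ =>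
      η * ((∑ j, q.1 j * x j) / Real.sqrt (n : ℝ)) + Real.sqrt γ * q.2) =
      (fun r : ℝ × ℝ => r.1 + r.2) ∘ (Prod.map
        (fun a => η * ((∑ j, a j * x j) / Real.sqrt (n : ℝ))) (fun g => Real.sqrt γ * g)) := by
    ext q; simp
  have hm := meanSq_nonneg x
  rw [h1, ← Measure.map_map (by fun_prop) (by fun_prop),
    ← Measure.map_prod_map _ _ (by fun_prop) (by fun_prop), stdGPi_map_mul_dot,
    stdG_map_const_mul, stdG_map_const_mul, Real.sq_sqrt hγ, Real.sq_sqrt (by positivity),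
    Real.toNNReal_add (by positivity) hγ]
  exact gaussianReal_conv_gaussianReal.trans (by simp)

lemma memLp_stdG (p : ENNReal) (hp : p ≠ ⊤) : MemLp (fun x => x) p stdG :=
  memLp_id_gaussianReal' p hp

lemma integrable_stdG_pow (k : ℕ) : Integrable (fun x : ℝ => x ^ k) stdG := by
  refine (integrable_norm_iff (by fun_prop)).1 ?_
  simpa [norm_pow] using (memLp_stdG k (by simp)).integrable_norm_pow'

lemma integral_stdG_sq : ∫ x, x ^ 2 ∂stdG = 1 := by
  have h : Var[fun x => x; stdG] = (1 : NNReal) := variance_fun_id_gaussianReal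
  rw [variance_eq_sub (memLp_stdG 2 (by simp))] at h
  simpa [integral_id_gaussianReal, stdG] using h

/-- Gaussian integration by parts for functions of linear growth. -/
lemma integral_stdG_mul_eq_deriv {u u' : ℝ → ℝ} (hu : ∀ x, HasDerivAt u (u' x) x)
    (hi : Integrable (fun x => u x * x) stdG) (hi' : Integrable u' stdG) (hui : Integrable u stdG) :
    ∫ x, u x * x ∂stdG = ∫ x, u' x ∂stdG := by
  have hd : ∀ x, HasDerivAt (gaussianPDFReal 0 1) (-x * gaussianPDFReal 0 1 x) x := by
    intro x
    have h := ((((hasDerivAt_id x).pow 2).neg.div_const 2).exp).const_mul (Real.sqrt (2 * Real.pi))⁻¹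
    refine (h.congr_of_eventuallyEq (f₁ := gaussianPDFReal 0 1)
      (Filter.Eventually.of_forall fun y => ?_)).congr_deriv ?_
    · simp [gaussianPDFReal]
    · simp [gaussianPDFReal]; ring
  have conv : ∀ g : ℝ → ℝ, Integrable g stdG ↔ Integrable (fun x => gaussianPDFReal 0 1 x * g x) := by
    intro g
    rw [stdG, gaussianReal_of_var_ne_zero _ one_ne_zero,
      integrable_withDensity_iff_integrable_smul' (measurable_gaussianPDF _ _)
        (ae_of_all _ fun _ => gaussianPDF_lt_top)]
    simp
  rw [stdG, integral_gaussianReal_eq_integral_smul one_ne_zero,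
    integral_gaussianReal_eq_integral_smul one_ne_zero]
  have h := integral_mul_deriv_eq_deriv_mul_of_integrable (u := u) (u' := u')
    (v := gaussianPDFReal 0 1) (v' := fun x => -x * gaussianPDFReal 0 1 x)
    (fun x _ => hu x) (fun x _ => hd x)
    (by refine ((conv _).1 hi).neg.congr (ae_of_all _ fun x => ?_); simp; ring)
    (by refine ((conv _).1 hi').congr (ae_of_all _ fun x => ?_); simp; ring)
    (by refine ((conv _).1 hui).congr (ae_of_all _ fun x => ?_); simp; ring)
  have e1 : ∫ x, gaussianPDFReal 0 1 x • (u x * x) = -∫ x, u x * (-x * gaussianPDFReal 0 1 x) := by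
    rw [← integral_neg]; congr 1; ext x; simp; ring
  rw [e1, h, neg_neg]
  congr 1; ext x; simp; ring

lemma meanSq_eq {n : ℕ} (x : Fin n → ℝ) : meanSq x = ∑ j, x j ^ 2 / n := by
  rw [meanSq, Finset.sum_div]

lemma integral_abs_le_sqrt_variance {Ω : Type*} [MeasurableSpace Ω] {μ : Measure Ω}
    [IsProbabilityMeasure μ] {Y : Ω → ℝ} (hY : MemLp Y 2 μ) :
    ∫ ω, |Y ω - ∫ ω', Y ω' ∂μ| ∂μ ≤ Real.sqrt Var[Y; μ] := by
  have hZ : MemLp (fun ω => |Y ω - ∫ ω', Y ω' ∂μ|) 2 μ := (hY.sub (memLp_const _)).abs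
  have h1 := variance_nonneg (fun ω => |Y ω - ∫ ω', Y ω' ∂μ|) μ
  rw [variance_eq_sub hZ] at h1
  rw [variance_eq_integral hY.aemeasurable]
  apply Real.le_sqrt_of_sq_le
  simp only [Pi.pow_apply, sq_abs] at h1
  linarith

/-- Law of large numbers in `L¹`, at rate `n ^ (-1/2)`, for squares of functions of linear growth
of independent Gaussians. -/
lemma lintegral_meanSq_sub_le {n : ℕ} (hn : 1 ≤ n) {ψ : ℝ → ℝ} (hψ : Measurable ψ) {K : ℝ}
    (hK : ∀ x, |ψ x| ≤ K * |x|) :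
    ∫⁻ g, ENNReal.ofReal |meanSq (fun i => ψ (g i)) - ∫ z, ψ z ^ 2 ∂stdG| ∂stdGPi n ≤
      ENNReal.ofReal (Real.sqrt (∫ z, z ^ 4 ∂stdG) * K ^ 2 / Real.sqrt n) := by
  have hn0 : (0 : ℝ) < n := by exact_mod_cast hn
  have hb : ∀ x, ψ x ^ 2 ≤ K ^ 2 * x ^ 2 := fun x => by
    have := pow_le_pow_left₀ (abs_nonneg _) (hK x) 2
    rwa [sq_abs, mul_pow, sq_abs] at this
  have hb4 : ∀ x, (ψ x ^ 2) ^ 2 ≤ K ^ 4 * x ^ 4 := fun x => by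
    have := pow_le_pow_left₀ (sq_nonneg _) (hb x) 2
    linarith [show (K ^ 2 * x ^ 2) ^ 2 = K ^ 4 * x ^ 4 by ring]
  have hi4 : Integrable (fun z => (ψ z ^ 2) ^ 2) stdG :=
    ((integrable_stdG_pow 4).const_mul (K ^ 4)).mono' (by fun_prop)
      (ae_of_all _ fun x => by rw [Real.norm_of_nonneg (by positivity)]; exact hb4 x)
  have hL : MemLp (fun z => ψ z ^ 2 / n) 2 stdG :=
    (memLp_two_iff_integrable_sq (by fun_prop)).2
      ((hi4.div_const ((n : ℝ) ^ 2)).congr (ae_of_all _ fun x => by simp; ring))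
  have hvar : Var[fun z => ψ z ^ 2 / n; stdG] ≤ K ^ 4 * (∫ z, z ^ 4 ∂stdG) / n ^ 2 := by
    refine (variance_le_expectation_sq (by fun_prop)).trans ?_
    rw [← integral_const_mul, ← integral_div]
    refine integral_mono hL.integrable_sq
      (((integrable_stdG_pow 4).const_mul _).div_const _) fun x => ?_
    simp only [Pi.pow_apply, div_pow]
    gcongr
    exact hb4 x
  set Y : (Fin n → ℝ) → ℝ := ∑ i, fun g => ψ (g i) ^ 2 / n with hYdef
  have hY : ∀ g, Y g = meanSq (fun i => ψ (g i)) := fun g => by simp [hYdef, meanSq_eq]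
  have hcomp : ∀ i : Fin n, MemLp (fun g : Fin n → ℝ => ψ (g i) ^ 2 / n) 2 (stdGPi n) := fun i =>
    hL.comp_measurePreserving (measurePreserving_eval _ i)
  have hYL : MemLp Y 2 (stdGPi n) := memLp_finsetSum' _ fun i _ => hcomp i
  have hV : Var[Y; stdGPi n] ≤ K ^ 4 * (∫ z, z ^ 4 ∂stdG) / n := by
    rw [hYdef, stdGPi, variance_sum_pi (X := fun _ z => ψ z ^ 2 / n) (fun _ => hL)]
    refine (Finset.sum_le_sum fun i _ => hvar).trans (le_of_eq ?_)
    simp; field_simp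
  have hE : ∫ g, Y g ∂stdGPi n = ∫ z, ψ z ^ 2 ∂stdG := by
    have : ∀ g, Y g = ∑ i, ψ (g i) ^ 2 / n := fun g => by simp [hYdef]
    simp_rw [this]
    rw [integral_finsetSum _ fun i _ => (hcomp i).integrable one_le_two]
    have h1 : ∀ i : Fin n, ∫ g, ψ (g i) ^ 2 / n ∂stdGPi n = ∫ z, ψ z ^ 2 / n ∂stdG := fun i =>
      integral_comp_eval (μ := fun _ : Fin n => stdG) (f := fun z => ψ z ^ 2 / n) (by fun_prop)
    simp_rw [h1, integral_div]
    simp; field_simp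
  have hmain := integral_abs_le_sqrt_variance hYL
  have hint : Integrable (fun g => |Y g - ∫ g', Y g' ∂stdGPi n|) (stdGPi n) :=
    ((hYL.integrable one_le_two).sub (integrable_const _)).abs
  have h2 : ∫ g, |Y g - ∫ g', Y g' ∂stdGPi n| ∂stdGPi n ≤
      Real.sqrt (∫ z, z ^ 4 ∂stdG) * K ^ 2 / Real.sqrt n := by
    refine hmain.trans ((Real.sqrt_le_sqrt hV).trans (le_of_eq ?_))
    rw [Real.sqrt_div' _ hn0.le, Real.sqrt_mul (by positivity),
      show K ^ 4 = (K ^ 2) ^ 2 by ring, Real.sqrt_sq (by positivity), mul_comm]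
  refine le_trans (le_of_eq ?_) (ENNReal.ofReal_le_ofReal h2)
  rw [ofReal_integral_eq_lintegral_ofReal hint (ae_of_all _ fun _ => abs_nonneg _)]
  simp_rw [hE, hY]

lemma integrable_sq_comp_mul {φ : ℝ → ℝ} (hφ : Measurable φ) {K : ℝ}
    (hK : ∀ x, |φ x| ≤ K * |x|) (s : ℝ) : Integrable (fun z => φ (z * s) ^ 2) stdG :=
  ((integrable_stdG_pow 2).const_mul ((K * s) ^ 2)).mono'
    (Measurable.aestronglyMeasurable (by fun_prop))
    (ae_of_all _ fun x => by
      rw [Real.norm_of_nonneg (by positivity)]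
      have := pow_le_pow_left₀ (abs_nonneg _) (hK (x * s)) 2
      rw [sq_abs, mul_pow, sq_abs] at this
      linarith [show K ^ 2 * (x * s) ^ 2 = (K * s) ^ 2 * x ^ 2 by ring])

/-- The Gaussian second moment of `φ` is Lipschitz in the variance. -/
lemma abs_integral_sq_sub_le {φ : ℝ → ℝ} (hφ : Measurable φ) {K : ℝ} (hK0 : 0 ≤ K)
    (hK : ∀ x, |φ x| ≤ K * |x|) (hlip : ∀ x y, |φ x - φ y| ≤ K * |x - y|)
    {q r : ℝ} (hq : 0 ≤ q) (hr : 0 ≤ r) :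
    |∫ z, φ (z * Real.sqrt q) ^ 2 ∂stdG - ∫ z, φ (z * Real.sqrt r) ^ 2 ∂stdG| ≤
      K ^ 2 * |q - r| := by
  rw [← integral_sub (integrable_sq_comp_mul hφ hK _) (integrable_sq_comp_mul hφ hK _)]
  have hpt : ∀ z : ℝ, ‖φ (z * Real.sqrt q) ^ 2 - φ (z * Real.sqrt r) ^ 2‖ ≤
      K ^ 2 * |q - r| * z ^ 2 := fun z => by
    set a := Real.sqrt q
    set b := Real.sqrt r
    have ha : 0 ≤ a := Real.sqrt_nonneg q
    have hb : 0 ≤ b := Real.sqrt_nonneg r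
    have h1 := hlip (z * a) (z * b)
    have h2 : |φ (z * a) + φ (z * b)| ≤ K * |z| * (a + b) := by
      refine (abs_add_le _ _).trans ((add_le_add (hK _) (hK _)).trans (le_of_eq ?_))
      rw [abs_mul, abs_mul, abs_of_nonneg ha, abs_of_nonneg hb]; ring
    rw [← mul_sub, abs_mul] at h1
    have hqr : |q - r| = |a - b| * (a + b) := by
      rw [← abs_of_nonneg (add_nonneg ha hb), ← abs_mul, ← Real.sq_sqrt hq, ← Real.sq_sqrt hr]
      congr 1; ring
    rw [Real.norm_eq_abs, sq_sub_sq, abs_mul]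
    calc _ ≤ (K * |z| * (a + b)) * (K * (|z| * |a - b|)) := by gcongr
      _ = K ^ 2 * |q - r| * |z| ^ 2 := by rw [hqr]; ring
      _ = _ := by rw [sq_abs]
  refine (norm_integral_le_of_norm_le ((integrable_stdG_pow 2).const_mul _)
    (ae_of_all _ hpt)).trans ?_
  rw [integral_const_mul, integral_stdG_sq, mul_one]

lemma sigmaC_nonneg (φ : ℝ → ℝ) (k : ℕ) : 0 ≤ sigmaC φ k := by
  cases k with
  | zero => simp [sigmaC]
  | succ k => exact integral_nonneg fun z => sq_nonneg _

/-- `ε_ℓ ≥ 0`, by Gaussian integration by parts and the Cauchy–Schwarz inequality. -/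
lemma epsC_succ_nonneg {φ : ℝ → ℝ} (hφ : ContDiff ℝ 2 φ) {K : ℝ}
    (hK : ∀ x, |φ x| ≤ K * |x|) (hd : ∀ x, |deriv φ x| ≤ K) (k : ℕ) :
    0 ≤ epsC φ (k + 1) := by
  have hdiff : Differentiable ℝ φ := hφ.differentiable (by norm_num)
  have hc : Continuous (deriv φ) := hφ.continuous_deriv (by norm_num)
  have hcφ : Continuous φ := hφ.continuous
  simp only [epsC, rhoC, Nat.add_sub_cancel, sigmaC]
  set s := Real.sqrt (sigmaC φ k) with hs
  have hs2 : sigmaC φ k = s ^ 2 := (Real.sq_sqrt (sigmaC_nonneg φ k)).symm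
  set r := ∫ z, deriv φ (z * s) ∂stdG
  have hsq := integrable_sq_comp_mul hcφ.measurable hK s
  have hL : MemLp (fun z => φ (z * s)) 2 stdG :=
    (memLp_two_iff_integrable_sq (by fun_prop)).2 hsq
  have hz : Integrable (fun z => φ (z * s) * z) stdG := hL.integrable_mul (memLp_stdG 2 (by simp))
  have hibp : ∫ z, φ (z * s) * z ∂stdG = s * r := by
    rw [integral_stdG_mul_eq_deriv (u' := fun z => s * deriv φ (z * s)) ?_ hz ?_
      (hL.integrable one_le_two), integral_const_mul]
    · intro x
      have := (hdiff (x * s)).hasDerivAt.comp x ((hasDerivAt_id x).mul_const s)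
      simpa [mul_comm, Function.comp_def] using this
    · exact Integrable.const_mul (Integrable.of_bound (by fun_prop) K
        (ae_of_all _ fun x => hd _)) s
  have h0 : 0 ≤ ∫ z, (φ (z * s) - s * r * z) ^ 2 ∂stdG := integral_nonneg fun z => sq_nonneg _
  have hexp : ∫ z, (φ (z * s) - s * r * z) ^ 2 ∂stdG =
      ∫ z, φ (z * s) ^ 2 ∂stdG - 2 * (s * r) * (s * r) + (s * r) ^ 2 := by
    calc _ = ∫ z, (φ (z * s) ^ 2 - 2 * (s * r) * (φ (z * s) * z)) + (s * r) ^ 2 * z ^ 2 ∂stdG := by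
          congr 1; ext z; ring
      _ = _ := by
          have hsub : Integrable (fun z => φ (z * s) ^ 2 - 2 * (s * r) * (φ (z * s) * z)) stdG :=
            hsq.sub (hz.const_mul _)
          rw [integral_add hsub ((integrable_stdG_pow 2).const_mul _),
            integral_sub hsq (hz.const_mul _), integral_const_mul, integral_const_mul, hibp,
            integral_stdG_sq, mul_one]
  rw [hexp] at h0
  rw [hs2]
  nlinarith

lemma eq_zero_of_sigmaC_eq_zero {φ : ℝ → ℝ} (hφ : Continuous φ) {K : ℝ}
    (hK : ∀ x, |φ x| ≤ K * |x|) :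
    ∀ k, sigmaC φ k = 0 → φ = 0
  | 0, h => by simp [sigmaC] at h
  | k + 1, h => by
    by_cases h0 : sigmaC φ k = 0
    · exact eq_zero_of_sigmaC_eq_zero hφ hK k h0
    have hs : Real.sqrt (sigmaC φ k) ≠ 0 :=
      (Real.sqrt_pos.2 (lt_of_le_of_ne (sigmaC_nonneg φ k) (Ne.symm h0))).ne'
    rw [sigmaC, integral_eq_zero_iff_of_nonneg (fun z => sq_nonneg _)
      (integrable_sq_comp_mul hφ.measurable hK _)] at h
    have h1 := (gaussianReal_absolutelyContinuous' 0 one_ne_zero).ae_le h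
    have h2 := (Continuous.ae_eq_iff_eq volume ((hφ.comp (continuous_mul_const _)).pow 2)
      continuous_zero).1 h1
    ext x
    have h3 := congrFun h2 (x / Real.sqrt (sigmaC φ k))
    simpa [div_mul_cancel₀ _ hs] using h3

/-- Resampling one coordinate of a product probability measure preserves it. -/
lemma measurePreserving_update {ι : Type*} [Fintype ι] [DecidableEq ι] {X : ι → Type*}
    [∀ i, MeasurableSpace (X i)] (μ : ∀ i, Measure (X i)) [∀ i, IsProbabilityMeasure (μ i)]
    (i : ι) :
    MeasurePreserving (fun q : (∀ j, X j) × X i => Function.update q.1 i q.2)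
      ((Measure.pi μ).prod (μ i)) (Measure.pi μ) := by
  have hm : Measurable (fun q : (∀ j, X j) × X i => Function.update q.1 i q.2) := by
    refine measurable_pi_lambda _ fun j => ?_
    by_cases h : j = i
    · subst h; simpa using measurable_snd
    · simp only [Function.update_of_ne h]; fun_prop
  refine ⟨hm, (Measure.pi_eq fun s hs => ?_).symm⟩
  have hpre : (fun q : (∀ j, X j) × X i => Function.update q.1 i q.2) ⁻¹' (Set.univ.pi s) =
      (Set.univ.pi (Function.update s i Set.univ)) ×ˢ s i := by
    ext q
    simp only [Set.mem_preimage, Set.mem_pi, Set.mem_univ, true_implies, Set.mem_prod]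
    constructor
    · intro h
      refine ⟨fun j => ?_, by simpa using h i⟩
      by_cases hj : j = i
      · subst hj; simp
      · simpa [hj] using h j
    · rintro ⟨h, h'⟩ j
      by_cases hj : j = i
      · subst hj; simpa using h'
      · simpa [hj] using h j
  rw [Measure.map_apply hm (MeasurableSet.univ_pi hs), hpre, Measure.prod_prod, Measure.pi_pi,
    ← Finset.mul_prod_erase _ _ (Finset.mem_univ i),
    ← Finset.mul_prod_erase Finset.univ (fun j => μ j (s j)) (Finset.mem_univ i)]
  simp only [Function.update_self, measure_univ, one_mul]
  rw [mul_comm]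
  congr 1
  exact Finset.prod_congr rfl fun j hj => by rw [Function.update_of_ne (Finset.ne_of_mem_erase hj)]

lemma feat_congr (φ : ℝ → ℝ) (d : ℕ → ℕ) {W W' : (ℓ : ℕ) → Fin (d (ℓ + 1)) → Fin (d ℓ) → ℝ}
    (x0 : Fin (d 0) → ℝ) : ∀ k, (∀ ℓ < k, W ℓ = W' ℓ) → feat φ d W x0 k = feat φ d W' x0 k
  | 0, _ => rfl
  | k + 1, h => by
    ext i
    rw [feat, feat, feat_congr φ d x0 k fun ℓ hℓ => h ℓ (hℓ.trans k.lt_succ_self),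
      h k k.lt_succ_self]

lemma measurable_extW (d : ℕ → ℕ) (L ℓ : ℕ) :
    Measurable (fun W : Wspace d L => extW W ℓ) := by
  unfold extW
  split_ifs with h
  · exact measurable_pi_apply (⟨ℓ, h⟩ : Fin L)
  · exact measurable_const

lemma measurable_feat {φ : ℝ → ℝ} (hφ : Measurable φ) (d : ℕ → ℕ) (L : ℕ) :
    ∀ k, Measurable (fun q : (Fin (d 0) → ℝ) × Wspace d L => feat φ d (extW q.2) q.1 k)
  | 0 => by simpa [feat] using measurable_fst
  | k + 1 => by
    have ih := measurable_feat hφ d L k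
    refine measurable_pi_lambda _ fun i => ?_
    simp only [feat]
    have hW : ∀ j, Measurable (fun q : (Fin (d 0) → ℝ) × Wspace d L => extW q.2 k i j) := fun j =>
      (measurable_pi_apply j).comp ((measurable_pi_apply i).comp
        ((measurable_extW d L k).comp measurable_snd))
    have hx : ∀ j, Measurable
        (fun q : (Fin (d 0) → ℝ) × Wspace d L => feat φ d (extW q.2) q.1 k j) := fun j =>
      (measurable_pi_apply j).comp ih
    exact hφ.comp ((Finset.measurable_fun_sum _ fun j _ => (hW j).mul (hx j)).div_const _)

lemma measurable_meanSq (n : ℕ) : Measurable (meanSq : (Fin n → ℝ) → ℝ) := by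
  unfold meanSq; fun_prop

/-- Empirical second moment of the `k`-th layer of features. -/
def layerSq (φ : ℝ → ℝ) (d : ℕ → ℕ) (L k : ℕ) (q : (Fin (d 0) → ℝ) × Wspace d L) : ℝ :=
  meanSq (feat φ d (extW q.2) q.1 k)

lemma measurable_layerSq {φ : ℝ → ℝ} (hφ : Measurable φ) (d : ℕ → ℕ) (L k : ℕ) :
    Measurable (layerSq φ d L k) :=
  (measurable_meanSq _).comp (measurable_feat hφ d L k)

lemma layerSq_nonneg (φ : ℝ → ℝ) (d : ℕ → ℕ) (L k : ℕ) (q : (Fin (d 0) → ℝ) × Wspace d L) :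
    0 ≤ layerSq φ d L k q := meanSq_nonneg _

/-- Joint law of the input and of the weights. -/
def inputMeasure (d : ℕ → ℕ) (L : ℕ) : Measure ((Fin (d 0) → ℝ) × Wspace d L) :=
  (stdGPi (d 0)).prod (Wmeasure d L)

instance (d : ℕ → ℕ) (L : ℕ) : IsProbabilityMeasure (inputMeasure d L) := by
  unfold inputMeasure; infer_instance

lemma extW_update_self {d : ℕ → ℕ} {L : ℕ} (W : Wspace d L) {k : ℕ} (hk : k < L)
    (w : Fin (d (k + 1)) → Fin (d k) → ℝ) :
    extW (Function.update W ⟨k, hk⟩ w) k = w := by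
  simp [extW, hk]

lemma extW_update_of_lt {d : ℕ → ℕ} {L : ℕ} (W : Wspace d L) {k : ℕ} (hk : k < L)
    (w : Fin (d (k + 1)) → Fin (d k) → ℝ) {ℓ : ℕ} (hℓ : ℓ < k) :
    extW (Function.update W ⟨k, hk⟩ w) ℓ = extW W ℓ := by
  have h : ℓ < L := hℓ.trans hk
  have hne : (⟨ℓ, h⟩ : Fin L) ≠ ⟨k, hk⟩ := fun e => hℓ.ne (Fin.mk.inj e)
  simp [extW, h, Function.update_of_ne hne]

/-- Given the previous layer, the next layer of features is `φ` applied to i.i.d. Gaussians. -/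
lemma lintegral_layerSq_succ {φ : ℝ → ℝ} (hφ : Measurable φ) {d : ℕ → ℕ} {L k : ℕ} (hk : k < L)
    {F : ℝ → ENNReal} (hF : Measurable F) :
    ∫⁻ q, F (layerSq φ d L (k + 1) q) ∂inputMeasure d L =
      ∫⁻ q, ∫⁻ g, F (meanSq fun i => φ (Real.sqrt (layerSq φ d L k q) * g i))
        ∂stdGPi (d (k + 1)) ∂inputMeasure d L := by
  have hm : Measurable fun q => F (layerSq φ d L (k + 1) q) := hF.comp (measurable_layerSq hφ d L _)
  have hmp := measurePreserving_update
    (fun ℓ : Fin L => Measure.pi fun _ : Fin (d ((ℓ : ℕ) + 1)) => stdGPi (d (ℓ : ℕ))) ⟨k, hk⟩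
  have hup : ∀ x0 : Fin (d 0) → ℝ, ∀ W : Wspace d L, ∀ w : Fin (d (k + 1)) → Fin (d k) → ℝ,
      layerSq φ d L (k + 1) (x0, Function.update W ⟨k, hk⟩ w) = meanSq fun i =>
        φ ((∑ j, w i j * feat φ d (extW W) x0 k j) / Real.sqrt (d k)) := by
    intro x0 W w
    simp only [layerSq]
    congr 1
    ext i
    simp only [feat, extW_update_self]
    rw [feat_congr φ d x0 k fun ℓ hℓ => extW_update_of_lt W hk w hℓ]
  have hin : ∀ x : Fin (d k) → ℝ,
      ∫⁻ w, F (meanSq fun i : Fin (d (k + 1)) => φ ((∑ j, w i j * x j) / Real.sqrt (d k)))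
        ∂(Measure.pi fun _ : Fin (d (k + 1)) => stdGPi (d k)) =
      ∫⁻ g, F (meanSq fun i => φ (Real.sqrt (meanSq x) * g i)) ∂stdGPi (d (k + 1)) := by
    intro x
    have h1 : Measurable fun u : Fin (d (k + 1)) → ℝ => F (meanSq fun i => φ (u i)) :=
      hF.comp ((measurable_meanSq _).comp (by fun_prop))
    have h2 := Measure.pi_map_pi (μ := fun _ : Fin (d (k + 1)) => stdGPi (d k))
      (f := fun _ (a : Fin (d k) → ℝ) => (∑ j, a j * x j) / Real.sqrt (d k)) (hμ := fun _ => by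
        have : IsProbabilityMeasure
          ((stdGPi (d k)).map fun a => (∑ j, a j * x j) / Real.sqrt (d k)) :=
          Measure.isProbabilityMeasure_map (Measurable.aemeasurable (by fun_prop))
        infer_instance) (fun _ => Measurable.aemeasurable (by fun_prop))
    have h3 := Measure.pi_map_pi (μ := fun _ : Fin (d (k + 1)) => stdG)
      (f := fun _ g => Real.sqrt (meanSq x) * g) (hμ := fun _ => by
        have : IsProbabilityMeasure (stdG.map fun g => Real.sqrt (meanSq x) * g) :=
          Measure.isProbabilityMeasure_map (by fun_prop)
        infer_instance) (fun _ => by fun_prop)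
    simp_rw [stdGPi_map_dot, ← h3] at h2
    have h4 := congrArg (fun m => ∫⁻ u, F (meanSq fun i => φ (u i)) ∂m) h2
    rw [lintegral_map h1 (by fun_prop), lintegral_map h1 (by fun_prop)] at h4
    exact h4
  rw [inputMeasure, lintegral_prod _ hm.aemeasurable]
  have hm2 : Measurable fun q : (Fin (d 0) → ℝ) × Wspace d L =>
      ∫⁻ g, F (meanSq fun i => φ (Real.sqrt (layerSq φ d L k q) * g i)) ∂stdGPi (d (k + 1)) := by
    refine Measurable.lintegral_prod_right' (f := fun r : ((Fin (d 0) → ℝ) × Wspace d L) ×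
      (Fin (d (k + 1)) → ℝ) => F (meanSq fun i => φ (Real.sqrt (layerSq φ d L k r.1) * r.2 i))) ?_
    have := measurable_layerSq hφ d L k
    exact hF.comp ((measurable_meanSq _).comp (by fun_prop))
  rw [lintegral_prod _ hm2.aemeasurable]
  congr 1
  ext x0
  have hmx : Measurable fun W : Wspace d L => F (layerSq φ d L (k + 1) (x0, W)) :=
    hm.comp measurable_prodMk_left
  rw [Wmeasure, ← hmp.lintegral_comp hmx, lintegral_prod]
  rotate_left 1
  · exact (hmx.comp hmp.measurable).aemeasurable
  congr 1
  ext W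
  simp_rw [hup]
  exact hin _

lemma one_le_dmin {d : ℕ → ℕ} {L : ℕ} (hd : ∀ ℓ ≤ L, 1 ≤ d ℓ) : 1 ≤ dmin d L :=
  (Finset.le_inf'_iff _ _).2 fun ℓ hℓ => hd ℓ (Nat.lt_succ_iff.1 (Finset.mem_range.1 hℓ))

lemma dmin_le (d : ℕ → ℕ) {L ℓ : ℕ} (hℓ : ℓ ≤ L) : dmin d L ≤ d ℓ :=
  Finset.inf'_le _ (Finset.mem_range.2 (Nat.lt_succ_of_le hℓ))

lemma div_sqrt_le_div_sqrt_dmin {d : ℕ → ℕ} {L ℓ : ℕ} (hd : ∀ ℓ ≤ L, 1 ≤ d ℓ) (hℓ : ℓ ≤ L)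
    {c : ℝ} (hc : 0 ≤ c) : c / Real.sqrt (d ℓ) ≤ c / Real.sqrt (dmin d L) := by
  have h1 : (0 : ℝ) < dmin d L := by exact_mod_cast one_le_dmin hd
  have h2 : (dmin d L : ℝ) ≤ d ℓ := by exact_mod_cast dmin_le d hℓ
  exact div_le_div_of_nonneg_left hc (Real.sqrt_pos.2 h1) (Real.sqrt_le_sqrt h2)

/-- The empirical second moment of each layer concentrates around its deterministic limit. -/
lemma lintegral_layerSq_sub_sigmaC_le {φ : ℝ → ℝ} (hφ : Measurable φ) {K : ℝ} (hK0 : 0 ≤ K)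
    (hK : ∀ x, |φ x| ≤ K * |x|) (hlip : ∀ x y, |φ x - φ y| ≤ K * |x - y|) (L : ℕ) :
    ∀ k ≤ L, ∃ C, 0 ≤ C ∧ ∀ d : ℕ → ℕ, (∀ ℓ ≤ L, 1 ≤ d ℓ) →
      ∫⁻ q, ENNReal.ofReal |layerSq φ d L k q - sigmaC φ k| ∂inputMeasure d L ≤
        ENNReal.ofReal (C / Real.sqrt (dmin d L))
  | 0, h0 => by
    refine ⟨Real.sqrt (∫ z, z ^ 4 ∂stdG) * 1 ^ 2, by positivity, fun d hd => ?_⟩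
    have h := lintegral_meanSq_sub_le (hd 0 h0) (ψ := fun x => x) measurable_id (K := 1) (by simp)
    rw [integral_stdG_sq] at h
    have hm : Measurable fun q : (Fin (d 0) → ℝ) × Wspace d L =>
        ENNReal.ofReal |layerSq φ d L 0 q - sigmaC φ 0| := by
      have := measurable_layerSq hφ d L 0
      exact (((this.sub_const _).abs)).ennreal_ofReal
    rw [inputMeasure, lintegral_prod _ hm.aemeasurable]
    simp only [layerSq, feat, sigmaC, lintegral_const, measure_univ, mul_one]
    exact h.trans (ENNReal.ofReal_le_ofReal (div_sqrt_le_div_sqrt_dmin hd h0 (by positivity)))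
  | k + 1, hk => by
    obtain ⟨C, hC, ih⟩ := lintegral_layerSq_sub_sigmaC_le hφ hK0 hK hlip L k (by omega)
    set c := Real.sqrt (∫ z, z ^ 4 ∂stdG) * K ^ 2 with hc
    have hc0 : 0 ≤ c := by positivity
    have hσ := sigmaC_nonneg φ k
    refine ⟨c * sigmaC φ k + (c + K ^ 2) * C, by positivity, fun d hd => ?_⟩
    have hD : (1 : ℝ) ≤ Real.sqrt (dmin d L) :=
      Real.one_le_sqrt.2 (by exact_mod_cast one_le_dmin hd)
    rw [lintegral_layerSq_succ hφ (Nat.lt_of_succ_le hk)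
      (F := fun x => ENNReal.ofReal |x - sigmaC φ (k + 1)|)
      ((measurable_id.sub_const _).abs.ennreal_ofReal)]
    have hpt : ∀ q, ∫⁻ g, ENNReal.ofReal |(meanSq fun i =>
          φ (Real.sqrt (layerSq φ d L k q) * g i)) - sigmaC φ (k + 1)| ∂stdGPi (d (k + 1)) ≤
        ENNReal.ofReal (c * sigmaC φ k / Real.sqrt (dmin d L)) +
          ENNReal.ofReal (c + K ^ 2) * ENNReal.ofReal |layerSq φ d L k q - sigmaC φ k| := by
      intro q
      have hq := layerSq_nonneg φ d L k q
      generalize layerSq φ d L k q = v at hq ⊢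
      have hlln := lintegral_meanSq_sub_le (hd (k + 1) hk) (ψ := fun x => φ (Real.sqrt v * x))
        (by fun_prop) (K := K * Real.sqrt v) (fun x => (hK _).trans (le_of_eq (by
          rw [abs_mul, abs_of_nonneg (Real.sqrt_nonneg v)]; ring)))
      have hm := abs_integral_sq_sub_le hφ hK0 hK hlip hq hσ
      rw [← sigmaC] at hm
      simp_rw [mul_comm _ (Real.sqrt v)] at hm
      set m := ∫ z, φ (Real.sqrt v * z) ^ 2 ∂stdG
      calc _ ≤ ∫⁻ g, (ENNReal.ofReal |(meanSq fun i => φ (Real.sqrt v * g i)) - m| +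
            ENNReal.ofReal (K ^ 2 * |v - sigmaC φ k|)) ∂stdGPi (d (k + 1)) := by
            refine lintegral_mono fun g => ?_
            rw [← ENNReal.ofReal_add (abs_nonneg _) (by positivity)]
            exact ENNReal.ofReal_le_ofReal ((abs_sub_le _ m _).trans (by gcongr))
        _ ≤ ENNReal.ofReal (Real.sqrt (∫ z, z ^ 4 ∂stdG) * (K * Real.sqrt v) ^ 2 /
              Real.sqrt (d (k + 1))) + ENNReal.ofReal (K ^ 2 * |v - sigmaC φ k|) := by
            rw [lintegral_add_right _ measurable_const, lintegral_const, measure_univ, mul_one]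
            gcongr
        _ ≤ _ := by
            rw [← ENNReal.ofReal_mul (by positivity), ← ENNReal.ofReal_add (by positivity)
              (by positivity), ← ENNReal.ofReal_add (by positivity) (by positivity)]
            apply ENNReal.ofReal_le_ofReal
            rw [mul_pow, Real.sq_sqrt hq, ← mul_assoc, ← hc]
            have h1 := div_sqrt_le_div_sqrt_dmin hd hk (mul_nonneg hc0 hq)
            have h2 : c * v / Real.sqrt (dmin d L) ≤
                c * sigmaC φ k / Real.sqrt (dmin d L) + c * |v - sigmaC φ k| := by
              have h3 : v ≤ sigmaC φ k + |v - sigmaC φ k| := by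
                linarith [le_abs_self (v - sigmaC φ k)]
              calc _ ≤ c * (sigmaC φ k + |v - sigmaC φ k|) / Real.sqrt (dmin d L) := by gcongr
                _ = c * sigmaC φ k / Real.sqrt (dmin d L) +
                    c * |v - sigmaC φ k| / Real.sqrt (dmin d L) := by ring
                _ ≤ _ := by
                  gcongr
                  exact div_le_self (by positivity) hD
            linarith
    refine (lintegral_mono hpt).trans ?_
    rw [lintegral_add_left measurable_const, lintegral_const, measure_univ, mul_one,
      lintegral_const_mul' _ _ ENNReal.ofReal_ne_top]
    calc _ ≤ ENNReal.ofReal (c * sigmaC φ k / Real.sqrt (dmin d L)) +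
          ENNReal.ofReal (c + K ^ 2) * ENNReal.ofReal (C / Real.sqrt (dmin d L)) := by
          gcongr
          exact ih d hd
      _ = _ := by
          rw [← ENNReal.ofReal_mul (by positivity), ← ENNReal.ofReal_add (by positivity)
              (by positivity)]
          congr 1
          ring

lemma integrable_layerSq_and_integral_le {φ : ℝ → ℝ} (hφ : Measurable φ) {K : ℝ} (hK0 : 0 ≤ K)
    (hK : ∀ x, |φ x| ≤ K * |x|) (hlip : ∀ x y, |φ x - φ y| ≤ K * |x - y|) {L k : ℕ} (hk : k ≤ L) :
    ∃ C, 0 ≤ C ∧ ∀ d : ℕ → ℕ, (∀ ℓ ≤ L, 1 ≤ d ℓ) →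
      Integrable (layerSq φ d L k) (inputMeasure d L) ∧
      ∫ q, |layerSq φ d L k q - sigmaC φ k| ∂inputMeasure d L ≤ C / Real.sqrt (dmin d L) := by
  obtain ⟨C, hC, h⟩ := lintegral_layerSq_sub_sigmaC_le hφ hK0 hK hlip L k hk
  refine ⟨C, hC, fun d hd => ?_⟩
  have hm := measurable_layerSq hφ d L k
  have hi : Integrable (fun q => layerSq φ d L k q - sigmaC φ k) (inputMeasure d L) := by
    refine ⟨(hm.sub_const _).aestronglyMeasurable, ?_⟩
    rw [hasFiniteIntegral_iff_norm]
    exact (h d hd).trans_lt ENNReal.ofReal_lt_top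
  refine ⟨(hi.add (integrable_const (sigmaC φ k))).congr (ae_of_all _ fun q => by simp), ?_⟩
  rw [← ENNReal.ofReal_le_ofReal_iff (by positivity),
    ofReal_integral_eq_lintegral_ofReal hi.abs (ae_of_all _ fun _ => abs_nonneg _)]
  exact h d hd

section Channel

variable {p : ℕ} (PA : Measure (Fin p → ℝ)) (Δ : ℝ) (f : ℝ → (Fin p → ℝ) → ℝ)

/-- Log-likelihood of the response generated from the signal `s`, the channel randomness `r.1` and
the label noise `r.2`. -/
def logLik (s : ℝ) (r : (Fin p → ℝ) × ℝ) : ℝ :=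
  Real.log (Pout PA Δ f (f s r.1 + Real.sqrt Δ * r.2) s)

variable {Δ f} [IsProbabilityMeasure PA]

lemma measurable_Pout (hf : Measurable (Function.uncurry f)) :
    Measurable (fun q : ℝ × ℝ => Pout PA Δ f q.1 q.2) := by
  have h : Measurable (fun r : (ℝ × ℝ) × (Fin p → ℝ) => f r.1.2 r.2) :=
    hf.comp (by fun_prop : Measurable fun r : (ℝ × ℝ) × (Fin p → ℝ) => (r.1.2, r.2))
  exact (StronglyMeasurable.integral_prod_right' (ν := PA)
    (f := fun r : (ℝ × ℝ) × (Fin p → ℝ) =>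
      Real.exp (-(r.1.1 - f r.1.2 r.2) ^ 2 / (2 * Δ)) / Real.sqrt (2 * Real.pi * Δ))
    (Measurable.stronglyMeasurable (by fun_prop))).measurable

lemma measurable_logLik (hf : Measurable (Function.uncurry f)) :
    Measurable (fun q : ℝ × ((Fin p → ℝ) × ℝ) => logLik PA Δ f q.1 q.2) := by
  have h : Measurable (fun q : ℝ × ((Fin p → ℝ) × ℝ) => f q.1 q.2.1) :=
    hf.comp (by fun_prop : Measurable fun q : ℝ × ((Fin p → ℝ) × ℝ) => (q.1, q.2.1))
  exact ((measurable_Pout PA hf).comp (by fun_prop :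
    Measurable fun q : ℝ × ((Fin p → ℝ) × ℝ) =>
      (f q.1 q.2.1 + Real.sqrt Δ * q.2.2, q.1))).log

lemma integrable_Pout_integrand (hΔ : 0 < Δ) (hf : Measurable (Function.uncurry f)) (y x : ℝ) :
    Integrable (fun A => Real.exp (-(y - f x A) ^ 2 / (2 * Δ)) /
      Real.sqrt (2 * Real.pi * Δ)) PA := by
  have hfx : Measurable (fun A => f x A) := hf.comp measurable_prodMk_left
  refine Integrable.div_const (Integrable.of_bound
    (Measurable.aestronglyMeasurable (by fun_prop)) 1 (ae_of_all _ fun A => ?_)) _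
  rw [Real.norm_of_nonneg (Real.exp_pos _).le, Real.exp_le_one_iff, neg_div, neg_nonpos]
  positivity

lemma Pout_pos (hΔ : 0 < Δ) (hf : Measurable (Function.uncurry f)) (y x : ℝ) :
    0 < Pout PA Δ f y x := by
  have hpos : ∀ A, 0 < Real.exp (-(y - f x A) ^ 2 / (2 * Δ)) / Real.sqrt (2 * Real.pi * Δ) :=
    fun A => by positivity
  refine (integral_pos_iff_support_of_nonneg (fun A => (hpos A).le)
    (integrable_Pout_integrand PA hΔ hf y x)).2 ?_
  rw [show Function.support (fun A => Real.exp (-(y - f x A) ^ 2 / (2 * Δ)) /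
      Real.sqrt (2 * Real.pi * Δ)) = Set.univ from
    Set.eq_univ_of_forall fun A => (hpos A).ne']
  simp

lemma logLik_sub_le (hΔ : 0 < Δ) (hf : Measurable (Function.uncurry f)) {K : ℝ} (hK0 : 0 ≤ K)
    (hf0 : ∀ A, f 0 A = 0) (hlip : ∀ s t A, |f s A - f t A| ≤ K * |s - t|)
    (s t : ℝ) (r : (Fin p → ℝ) × ℝ) :
    logLik PA Δ f s r - logLik PA Δ f t r ≤
      (2 * K ^ 2 + 2 * K * Real.sqrt Δ) / Δ * |s - t| * (|s| + |t| + |r.2|) := by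
  set D := Real.sqrt Δ
  have hD : 0 ≤ D := Real.sqrt_nonneg Δ
  set M := (2 * K ^ 2 + 2 * K * D) / Δ * |s - t| * (|s| + |t| + |r.2|) with hM
  have hs0 : ∀ s A, |f s A| ≤ K * |s| := fun s A => by simpa [hf0] using hlip s 0 A
  have hu : ∀ A, (f t r.1 + D * r.2 - f t A) ^ 2 - (f s r.1 + D * r.2 - f s A) ^ 2 ≤
      2 * Δ * M := by
    intro A
    have hu0 : ∀ s, |f s r.1 + D * r.2 - f s A| ≤ 2 * K * |s| + D * |r.2| := fun s => by
      have h1 := hs0 s r.1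
      have h2 := hs0 s A
      have h3 : |D * r.2| = D * |r.2| := by rw [abs_mul, abs_of_nonneg hD]
      have h4 := abs_sub (f s r.1 + D * r.2) (f s A)
      have h5 := abs_add_le (f s r.1) (D * r.2)
      linarith
    have hdiff : |(f t r.1 + D * r.2 - f t A) - (f s r.1 + D * r.2 - f s A)| ≤
        2 * K * |s - t| := by
      have h1 := hlip t s r.1
      have h2 := hlip s t A
      rw [abs_sub_comm t s] at h1
      have h3 := abs_add_le (f t r.1 - f s r.1) (f s A - f t A)
      rw [show (f t r.1 + D * r.2 - f t A) - (f s r.1 + D * r.2 - f s A) =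
        (f t r.1 - f s r.1) + (f s A - f t A) by ring]
      linarith
    have hsum : |(f t r.1 + D * r.2 - f t A) + (f s r.1 + D * r.2 - f s A)| ≤
        (2 * K + 2 * D) * (|s| + |t| + |r.2|) := by
      refine (abs_add_le _ _).trans ((add_le_add (hu0 t) (hu0 s)).trans ?_)
      nlinarith [mul_nonneg hD (abs_nonneg s), mul_nonneg hD (abs_nonneg t),
        mul_nonneg hK0 (abs_nonneg r.2)]
    rw [sq_sub_sq]
    refine (le_abs_self _).trans ?_
    rw [abs_mul]
    calc _ ≤ ((2 * K + 2 * D) * (|s| + |t| + |r.2|)) * (2 * K * |s - t|) := by gcongr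
      _ = 2 * Δ * M := by rw [hM]; field_simp
  have hle : Pout PA Δ f (f s r.1 + D * r.2) s ≤
      Real.exp M * Pout PA Δ f (f t r.1 + D * r.2) t := by
    rw [Pout, Pout, ← integral_const_mul]
    refine integral_mono (integrable_Pout_integrand PA hΔ hf _ _)
      ((integrable_Pout_integrand PA hΔ hf _ _).const_mul _) fun A => ?_
    simp only
    rw [← mul_div_assoc, ← Real.exp_add]
    gcongr
    rw [← sub_le_iff_le_add, ← sub_div, div_le_iff₀ (by positivity)]
    linarith [hu A]
  have h1 := Real.log_le_log (Pout_pos PA hΔ hf _ _) hle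
  rw [Real.log_mul (Real.exp_pos _).ne' (Pout_pos PA hΔ hf _ _).ne', Real.log_exp] at h1
  rw [logLik, logLik]
  linarith

lemma abs_logLik_sub_le (hΔ : 0 < Δ) (hf : Measurable (Function.uncurry f)) {K : ℝ} (hK0 : 0 ≤ K)
    (hf0 : ∀ A, f 0 A = 0) (hlip : ∀ s t A, |f s A - f t A| ≤ K * |s - t|)
    (s t : ℝ) (r : (Fin p → ℝ) × ℝ) :
    |logLik PA Δ f s r - logLik PA Δ f t r| ≤
      (2 * K ^ 2 + 2 * K * Real.sqrt Δ) / Δ * |s - t| * (|s| + |t| + |r.2|) := by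
  refine abs_sub_le_iff.2 ⟨logLik_sub_le PA hΔ hf hK0 hf0 hlip s t r, ?_⟩
  have := logLik_sub_le PA hΔ hf hK0 hf0 hlip t s r
  rwa [abs_sub_comm, add_comm |t| |s|] at this

lemma integrable_logLik_zero (hΔ : 0 < Δ) (hf0 : ∀ A, f 0 A = 0) :
    Integrable (logLik PA Δ f 0) (PA.prod stdG) := by
  have h : ∀ r, logLik PA Δ f 0 r = -(r.2 ^ 2) / 2 - Real.log (Real.sqrt (2 * Real.pi * Δ)) := by
    intro r
    simp only [logLik, Pout, hf0, zero_add, sub_zero, integral_const, probReal_univ, one_smul]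
    rw [Real.log_div (Real.exp_pos _).ne' (by positivity), Real.log_exp, mul_pow,
      Real.sq_sqrt hΔ.le]
    field_simp
  rw [funext h]
  exact (((integrable_stdG_pow 2).comp_snd PA).neg.div_const 2).sub (integrable_const _)

/-- `Ψ_k` only depends on the features through the variance of the pre-channel signal. -/
lemma PsiK_eq_integral (L : ℕ) {φ : ℝ → ℝ} (hφ : Measurable φ)
    (hf : Measurable (Function.uncurry f)) (d : ℕ → ℕ) (k : ℕ) (η : ℝ) {γ : ℝ} (hγ : 0 ≤ γ) :
    PsiK L p PA Δ φ f d k η γ =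
      ∫ ω, logLik PA Δ f (Real.sqrt (η ^ 2 * layerSq φ d L k ω.1 + γ) * ω.2.1) ω.2.2
        ∂((inputMeasure d L).prod (stdG.prod (PA.prod stdG))) := by
  set T₁ : (Fin (d 0) → ℝ) × Wspace d L × (Fin (d k) → ℝ) × ℝ × (Fin p → ℝ) × ℝ →
      ℝ × ((Fin p → ℝ) × ℝ) := fun ω =>
    (η * ((∑ i, ω.2.2.1 i * feat φ d (extW ω.2.1) ω.1 k i) / Real.sqrt (d k : ℝ)) +
      Real.sqrt γ * ω.2.2.2.1, ω.2.2.2.2)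
  set T₂ : ((Fin (d 0) → ℝ) × Wspace d L) × ℝ × (Fin p → ℝ) × ℝ → ℝ × ((Fin p → ℝ) × ℝ) :=
    fun ω => (Real.sqrt (η ^ 2 * layerSq φ d L k ω.1 + γ) * ω.2.1, ω.2.2)
  have hfeat : ∀ i, Measurable (fun ω : (Fin (d 0) → ℝ) × Wspace d L × (Fin (d k) → ℝ) × ℝ ×
      (Fin p → ℝ) × ℝ => feat φ d (extW ω.2.1) ω.1 k i) := fun i =>
    (measurable_pi_apply i).comp ((measurable_feat hφ d L k).comp
      (measurable_fst.prodMk (measurable_fst.comp measurable_snd)))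
  have hm₁ : Measurable T₁ := by
    refine Measurable.prodMk ?_ (by fun_prop)
    have hs : Measurable (fun ω : (Fin (d 0) → ℝ) × Wspace d L × (Fin (d k) → ℝ) × ℝ ×
        (Fin p → ℝ) × ℝ => ∑ i, ω.2.2.1 i * feat φ d (extW ω.2.1) ω.1 k i) :=
      Finset.measurable_fun_sum _ fun i _ => Measurable.mul (by fun_prop) (hfeat i)
    exact ((hs.div_const _).const_mul η).add (by fun_prop)
  have hm₂ : Measurable T₂ := by
    have := measurable_layerSq hφ d L k
    fun_prop
  have hmap : ((stdGPi (d 0)).prod ((Wmeasure d L).prod ((stdGPi (d k)).prod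
      (stdG.prod (PA.prod stdG))))).map T₁ =
      ((inputMeasure d L).prod (stdG.prod (PA.prod stdG))).map T₂ := by
    refine Measure.ext_of_lintegral _ fun F hF => ?_
    have hF₁ : Measurable fun ω => F (T₁ ω) := hF.comp hm₁
    have hF₂ : Measurable fun ω => F (T₂ ω) := hF.comp hm₂
    rw [lintegral_map hF hm₁, lintegral_map hF hm₂,
      lintegral_prod _ hF₁.aemeasurable, lintegral_prod _ hF₂.aemeasurable,
      inputMeasure, lintegral_prod _ hF₂.lintegral_prod_right'.aemeasurable]
    congr 1
    ext x0
    have h1 : Measurable fun ω => F (T₁ (x0, ω)) := hF₁.comp measurable_prodMk_left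
    rw [lintegral_prod _ h1.aemeasurable]
    congr 1
    ext W
    have h2 : Measurable fun ω => F (T₁ (x0, W, ω)) := h1.comp measurable_prodMk_left
    have h3 : Measurable fun ω => F (T₂ ((x0, W), ω)) := hF₂.comp measurable_prodMk_left
    have hG : Measurable fun s => ∫⁻ r, F (s, r) ∂(PA.prod stdG) := hF.lintegral_prod_right'
    rw [lintegral_prod _ h2.aemeasurable, lintegral_prod _ h3.aemeasurable]
    have h4 : ∀ a, ∫⁻ ω, F (T₁ (x0, W, a, ω)) ∂(stdG.prod (PA.prod stdG)) =
        ∫⁻ ξ, ∫⁻ r, F (T₁ (x0, W, a, ξ, r)) ∂(PA.prod stdG) ∂stdG := fun a =>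
      lintegral_prod _ (h2.comp measurable_prodMk_left).aemeasurable
    simp_rw [h4]
    have hsig := signal_map (feat φ d (extW W) x0 k) η γ hγ
    have h5 := congrArg (fun m => ∫⁻ s, ∫⁻ r, F (s, r) ∂(PA.prod stdG) ∂m) hsig
    rw [lintegral_map hG (by fun_prop), lintegral_map hG (by fun_prop)] at h5
    refine Eq.trans (Eq.symm ?_) h5
    refine lintegral_prod _ (Measurable.aemeasurable ?_)
    exact hG.comp (by fun_prop : Measurable fun q : (Fin (d k) → ℝ) × ℝ =>
      η * ((∑ j, q.1 j * feat φ d (extW W) x0 k j) / Real.sqrt (d k : ℝ)) + Real.sqrt γ * q.2)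
  have hlm := measurable_logLik PA (Δ := Δ) hf
  have h6 := congrArg (fun m => ∫ q, logLik PA Δ f q.1 q.2 ∂m) hmap
  rw [integral_map hm₁.aemeasurable hlm.aestronglyMeasurable,
    integral_map hm₂.aemeasurable hlm.aestronglyMeasurable] at h6
  exact h6

end Channel

/-- Gaussian averages of functions of linearly growing Lipschitz constant are stable under
fluctuations of the variance around a positive value. -/
lemma abs_integral_sqrt_mul_sub_le {Ω E : Type*} [MeasurableSpace Ω] [MeasurableSpace E]
    {P : Measure Ω} [IsProbabilityMeasure P] {Q : Measure E} [IsProbabilityMeasure Q]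
    {Φ : ℝ → E × ℝ → ℝ} (hΦ : Measurable (Function.uncurry Φ)) {c : ℝ} (hc : 0 ≤ c)
    (hlip : ∀ s t r, |Φ s r - Φ t r| ≤ c * |s - t| * (|s| + |t| + |r.2|))
    (hΦ0 : Integrable (Φ 0) (Q.prod stdG))
    {v : Ω → ℝ} (hv : Measurable v) (hv0 : ∀ ω, 0 ≤ v ω) (hvi : Integrable v P)
    {w : ℝ} (hw : 0 < w) :
    |∫ ω, Φ (Real.sqrt (v ω.1) * ω.2.1) ω.2.2 ∂(P.prod (stdG.prod (Q.prod stdG))) -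
      ∫ ω, Φ (Real.sqrt w * ω.2.1) ω.2.2 ∂(P.prod (stdG.prod (Q.prod stdG)))| ≤
      2 * (c * (1 + 1 / Real.sqrt w)) * ∫ ω, |v ω - w| ∂P := by
  have hb : 0 < Real.sqrt w := Real.sqrt_pos.2 hw
  have hR1 : Integrable (fun y : ℝ × E × ℝ => y.1 ^ 2) (stdG.prod (Q.prod stdG)) :=
    (integrable_stdG_pow 2).comp_fst _
  have hR2 : Integrable (fun y : ℝ × E × ℝ => y.2.2 ^ 2) (stdG.prod (Q.prod stdG)) :=
    ((integrable_stdG_pow 2).comp_snd Q).comp_snd stdG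
  have hR : ∫ y : ℝ × E × ℝ, (y.1 ^ 2 + y.2.2 ^ 2) ∂(stdG.prod (Q.prod stdG)) = 2 := by
    rw [integral_add hR1 hR2, integral_fun_fst (fun x : ℝ => x ^ 2),
      integral_fun_snd (fun y : E × ℝ => y.2 ^ 2), integral_fun_snd (fun x : ℝ => x ^ 2)]
    simp [integral_stdG_sq]
    norm_num
  set c' := c * (1 + 1 / Real.sqrt w) with hc'
  have habs : Integrable (fun ω => |v ω - w|) P := (hvi.sub (integrable_const w)).abs
  have hdom : Integrable (fun ω : Ω × ℝ × E × ℝ =>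
      c' * (|v ω.1 - w| * (ω.2.1 ^ 2 + ω.2.2.2 ^ 2))) (P.prod (stdG.prod (Q.prod stdG))) :=
    (habs.mul_prod (hR1.add hR2)).const_mul c'
  have hpt : ∀ ω : Ω × ℝ × E × ℝ,
      ‖Φ (Real.sqrt (v ω.1) * ω.2.1) ω.2.2 - Φ (Real.sqrt w * ω.2.1) ω.2.2‖ ≤
        c' * (|v ω.1 - w| * (ω.2.1 ^ 2 + ω.2.2.2 ^ 2)) := by
    rintro ⟨ω, g, r⟩
    simp only
    have ha := Real.sqrt_nonneg (v ω)
    have hqr : |v ω - w| = |Real.sqrt (v ω) - Real.sqrt w| * (Real.sqrt (v ω) + Real.sqrt w) := by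
      conv_rhs => rw [← abs_of_nonneg (add_nonneg ha hb.le), ← abs_mul]
      conv_lhs => rw [← Real.sq_sqrt (hv0 ω), ← Real.sq_sqrt hw.le]
      congr 1; ring
    set a := Real.sqrt (v ω)
    set b := Real.sqrt w
    have h1 : |a - b| ≤ |v ω - w| * (1 / b) := by
      rw [mul_one_div, le_div_iff₀ hb, hqr]
      gcongr
      linarith
    have h2 : |g| * |r.2| ≤ g ^ 2 + r.2 ^ 2 := by
      rw [← sq_abs g, ← sq_abs r.2]
      nlinarith [sq_nonneg (|g| - |r.2|), sq_nonneg |g|, sq_nonneg |r.2|]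
    have h3 : g ^ 2 ≤ g ^ 2 + r.2 ^ 2 := by linarith [sq_nonneg r.2]
    rw [Real.norm_eq_abs]
    refine (hlip _ _ _).trans ?_
    rw [← sub_mul, abs_mul, abs_mul, abs_mul, abs_of_nonneg ha, abs_of_nonneg hb.le]
    calc c * (|a - b| * |g|) * (a * |g| + b * |g| + |r.2|)
        = c * (|a - b| * (a + b) * |g| ^ 2 + |a - b| * (|g| * |r.2|)) := by ring
      _ ≤ c * (|v ω - w| * (g ^ 2 + r.2 ^ 2) + |v ω - w| * (1 / b) * (g ^ 2 + r.2 ^ 2)) := by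
          rw [← hqr, sq_abs]; gcongr
      _ = _ := by rw [hc']; ring
  have hm : ∀ u : Ω → ℝ, Measurable u → AEStronglyMeasurable
      (fun ω : Ω × ℝ × E × ℝ => Φ (u ω.1 * ω.2.1) ω.2.2) (P.prod (stdG.prod (Q.prod stdG))) :=
    fun u hu => (hΦ.comp (by fun_prop :
      Measurable fun ω : Ω × ℝ × E × ℝ => (u ω.1 * ω.2.1, ω.2.2))).aestronglyMeasurable
  have hdiff : Integrable (fun ω : Ω × ℝ × E × ℝ =>
      Φ (Real.sqrt (v ω.1) * ω.2.1) ω.2.2 - Φ (Real.sqrt w * ω.2.1) ω.2.2)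
      (P.prod (stdG.prod (Q.prod stdG))) :=
    hdom.mono' ((hm (fun ω => Real.sqrt (v ω)) (by fun_prop)).sub
      (hm (fun _ => Real.sqrt w) measurable_const)) (ae_of_all _ hpt)
  have href : Integrable (fun ω : Ω × ℝ × E × ℝ => Φ (Real.sqrt w * ω.2.1) ω.2.2)
      (P.prod (stdG.prod (Q.prod stdG))) := by
    have h0 : Integrable (fun ω : Ω × ℝ × E × ℝ => Φ 0 ω.2.2) (P.prod (stdG.prod (Q.prod stdG))) :=
      (hΦ0.comp_snd stdG).comp_snd P
    have hd2 : Integrable (fun ω : Ω × ℝ × E × ℝ =>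
        c * (w + Real.sqrt w) * (ω.2.1 ^ 2 + ω.2.2.2 ^ 2)) (P.prod (stdG.prod (Q.prod stdG))) :=
      ((hR1.add hR2).comp_snd P).const_mul _
    have hd3 : Integrable (fun ω : Ω × ℝ × E × ℝ => Φ (Real.sqrt w * ω.2.1) ω.2.2 - Φ 0 ω.2.2)
        (P.prod (stdG.prod (Q.prod stdG))) := by
      refine hd2.mono' ((hm (fun _ => Real.sqrt w) measurable_const).sub h0.aestronglyMeasurable)
        (ae_of_all _ ?_)
      rintro ⟨ω, g, r⟩
      simp only
      rw [Real.norm_eq_abs]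
      refine (hlip _ _ _).trans ?_
      rw [sub_zero, abs_zero, add_zero, abs_mul, abs_of_nonneg hb.le]
      have h2 : |g| * |r.2| ≤ g ^ 2 + r.2 ^ 2 := by
        rw [← sq_abs g, ← sq_abs r.2]
        nlinarith [sq_nonneg (|g| - |r.2|), sq_nonneg |g|, sq_nonneg |r.2|]
      have h3 : g ^ 2 ≤ g ^ 2 + r.2 ^ 2 := by linarith [sq_nonneg r.2]
      calc c * (Real.sqrt w * |g|) * (Real.sqrt w * |g| + |r.2|)
          = c * (Real.sqrt w ^ 2 * |g| ^ 2 + Real.sqrt w * (|g| * |r.2|)) := by ring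
        _ ≤ c * (w * (g ^ 2 + r.2 ^ 2) + Real.sqrt w * (g ^ 2 + r.2 ^ 2)) := by
            rw [Real.sq_sqrt hw.le, sq_abs]; gcongr
        _ = _ := by ring
    exact (hd3.add h0).congr (ae_of_all _ fun ω => by simp)
  have hfst : Integrable (fun ω : Ω × ℝ × E × ℝ => Φ (Real.sqrt (v ω.1) * ω.2.1) ω.2.2)
      (P.prod (stdG.prod (Q.prod stdG))) :=
    (hdiff.add href).congr (ae_of_all _ fun ω => by simp)
  rw [← integral_sub hfst href]
  refine (norm_integral_le_of_norm_le hdom (ae_of_all _ hpt)).trans (le_of_eq ?_)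
  rw [integral_const_mul, integral_prod_mul (fun ω => |v ω - w|)
    (fun y : ℝ × E × ℝ => y.1 ^ 2 + y.2.2 ^ 2), hR]
  ring

lemma abs_sub_le_of_abs_deriv_le {g : ℝ → ℝ} (hg : ContDiff ℝ 2 g) {K : ℝ}
    (hK : ∀ x, |deriv g x| ≤ K) (x y : ℝ) : |g x - g y| ≤ K * |x - y| :=
  Convex.norm_image_sub_le_of_norm_deriv_le (s := Set.univ)
    (fun z _ => (hg.differentiable (by norm_num)) z) (fun z _ => hK z) convex_univ
    (Set.mem_univ y) (Set.mem_univ x)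

/-- **Lemma (closeness of the constant mutual-information terms).** With
`η_L = ρ, γ_L = ε, η_{L−1} = ρρ_L, γ_{L−1} = ρ²ε_L + ε`, one has
`|Ψ_L − Ψ_{L−1}| ≤ C/√d_m` with `C` depending only on `φ, f, ρ, ε, Δ, L`. -/
theorem Psi_constant_terms_close
    (L p : ℕ) (hL : 1 ≤ L)
    (PA : Measure (Fin p → ℝ)) [IsProbabilityMeasure PA]
    (Δ ρ ε : ℝ) (hΔ : 0 < Δ) (hρ : 0 < ρ) (hε : 0 ≤ ε)
    (φ : ℝ → ℝ) (f : ℝ → (Fin p → ℝ) → ℝ)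
    (hφC2 : ContDiff ℝ 2 φ) (hφodd : ∀ x, φ (-x) = -φ x)
    (hφbd : ∃ K, ∀ x, |deriv φ x| ≤ K ∧ |deriv (deriv φ) x| ≤ K)
    (hfC2 : ∀ A, ContDiff ℝ 2 (fun x => f x A))
    (hfodd : ∀ x A, f (-x) A = -f x A)
    (hfbd : ∃ K, ∀ x A, |deriv (fun x' => f x' A) x| ≤ K ∧
      |deriv (deriv (fun x' => f x' A)) x| ≤ K)
    (hfmeas : Measurable (Function.uncurry f)) :
    ∃ C > 0, ∀ d : ℕ → ℕ, (∀ ℓ ≤ L, 1 ≤ d ℓ) →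
      |PsiK L p PA Δ φ f d L ρ ε -
        PsiK L p PA Δ φ f d (L - 1) (ρ * rhoC φ L) (ρ ^ 2 * epsC φ L + ε)| ≤
      C / Real.sqrt (dmin d L : ℝ) := by
  obtain ⟨K, hφK⟩ := hφbd
  obtain ⟨K', hfK⟩ := hfbd
  have hK0 : 0 ≤ K := (abs_nonneg _).trans (hφK 0).1
  have hK0' : 0 ≤ K' := (abs_nonneg _).trans (hfK 0 fun _ => 0).1
  have hφ0 : φ 0 = 0 := by have := hφodd 0; rw [neg_zero] at this; linarith
  have hf0 : ∀ A, f 0 A = 0 := fun A => by have := hfodd 0 A; rw [neg_zero] at this; linarith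
  have hφlip := abs_sub_le_of_abs_deriv_le hφC2 fun x => (hφK x).1
  have hφlin : ∀ x, |φ x| ≤ K * |x| := fun x => by simpa [hφ0] using hφlip x 0
  have hflip : ∀ s t A, |f s A - f t A| ≤ K' * |s - t| := fun s t A =>
    abs_sub_le_of_abs_deriv_le (hfC2 A) (fun x => (hfK x A).1) s t
  have hφm : Measurable φ := hφC2.continuous.measurable
  obtain ⟨k, rfl⟩ : ∃ k, L = k + 1 := ⟨L - 1, by omega⟩
  simp only [Nat.add_sub_cancel]
  have hγ : 0 ≤ ρ ^ 2 * epsC φ (k + 1) + ε :=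
    add_nonneg (mul_nonneg (sq_nonneg ρ)
      (epsC_succ_nonneg hφC2 hφlin (fun x => (hφK x).1) k)) hε
  have hPsi := fun d => PsiK_eq_integral PA (Δ := Δ) (k + 1) hφm hfmeas d (k + 1) ρ hε
  have hPsi' := fun d => PsiK_eq_integral PA (Δ := Δ) (k + 1) hφm hfmeas d k
    (ρ * rhoC φ (k + 1)) hγ
  set w := ρ ^ 2 * sigmaC φ (k + 1) + ε with hw
  have hσ := sigmaC_nonneg φ (k + 1)
  rcases (show 0 ≤ w by positivity).eq_or_lt with hw0 | hw0
  · have hσ0 : sigmaC φ (k + 1) = 0 := by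
      have h1 : ρ ^ 2 * sigmaC φ (k + 1) = 0 := by
        have : 0 ≤ ρ ^ 2 * sigmaC φ (k + 1) := by positivity
        linarith
      exact (mul_eq_zero.1 h1).resolve_left (by positivity)
    have hε0 : ε = 0 := by rw [hσ0] at hw; linarith
    obtain rfl := eq_zero_of_sigmaC_eq_zero hφC2.continuous hφlin (k + 1) hσ0
    have hr : rhoC 0 (k + 1) = 0 := by
      have : deriv (0 : ℝ → ℝ) = 0 := by ext x; exact deriv_const x 0
      simp [rhoC, this]
    refine ⟨1, one_pos, fun d _ => ?_⟩
    have hl : ∀ q, layerSq 0 d (k + 1) (k + 1) q = 0 := fun q => by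
      simp [layerSq, feat, meanSq]
    rw [hPsi, hPsi']
    simp only [hl, hr, epsC, hσ0, hε0]
    simp
  · obtain ⟨C₁, hC₁, h₁⟩ := integrable_layerSq_and_integral_le hφm hK0 hφlin hφlip
      (le_refl (k + 1))
    obtain ⟨C₂, hC₂, h₂⟩ := integrable_layerSq_and_integral_le hφm hK0 hφlin hφlip
      (Nat.le_succ k)
    set c := (2 * K' ^ 2 + 2 * K' * Real.sqrt Δ) / Δ
    have hc : 0 ≤ c := by positivity
    set c' := 2 * (c * (1 + 1 / Real.sqrt w)) with hc'
    have hc'0 : 0 ≤ c' := by positivity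
    refine ⟨c' * (ρ ^ 2 * C₁) + c' * ((ρ * rhoC φ (k + 1)) ^ 2 * C₂) + 1, by positivity,
      fun d hd => ?_⟩
    have key : ∀ (ℓ : ℕ) (η γ C : ℝ), 0 ≤ γ → η ^ 2 * sigmaC φ ℓ + γ = w →
        Integrable (layerSq φ d (k + 1) ℓ) (inputMeasure d (k + 1)) →
        ∫ q, |layerSq φ d (k + 1) ℓ q - sigmaC φ ℓ| ∂inputMeasure d (k + 1) ≤
          C / Real.sqrt (dmin d (k + 1)) →
        |∫ ω, logLik PA Δ f (Real.sqrt (η ^ 2 * layerSq φ d (k + 1) ℓ ω.1 + γ) * ω.2.1) ω.2.2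
            ∂((inputMeasure d (k + 1)).prod (stdG.prod (PA.prod stdG))) -
          ∫ ω, logLik PA Δ f (Real.sqrt w * ω.2.1) ω.2.2
            ∂((inputMeasure d (k + 1)).prod (stdG.prod (PA.prod stdG)))| ≤
          c' * (η ^ 2 * C) / Real.sqrt (dmin d (k + 1)) := by
      intro ℓ η γ C hγ hηγ hi hC
      have hlm := measurable_layerSq hφm d (k + 1) ℓ
      have h := abs_integral_sqrt_mul_sub_le (P := inputMeasure d (k + 1)) (Q := PA)
        (Φ := logLik PA Δ f) (measurable_logLik PA hfmeas) hc
        (abs_logLik_sub_le PA hΔ hfmeas hK0' hf0 hflip) (integrable_logLik_zero PA hΔ hf0)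
        (v := fun q => η ^ 2 * layerSq φ d (k + 1) ℓ q + γ) (by fun_prop)
        (fun q => add_nonneg (mul_nonneg (sq_nonneg η) (layerSq_nonneg φ d (k + 1) ℓ q)) hγ)
        ((hi.const_mul _).add (integrable_const γ)) hw0
      refine h.trans ?_
      have habs : ∀ q, |η ^ 2 * layerSq φ d (k + 1) ℓ q + γ - w| =
          η ^ 2 * |layerSq φ d (k + 1) ℓ q - sigmaC φ ℓ| := fun q => by
        rw [← hηγ, add_sub_add_right_eq_sub, ← mul_sub, abs_mul, abs_of_nonneg (sq_nonneg η)]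
      simp_rw [habs, integral_const_mul]
      rw [mul_div_assoc, mul_div_assoc]
      gcongr
    have b₁ := key (k + 1) ρ ε C₁ hε rfl (h₁ d hd).1 (h₁ d hd).2
    have b₂ := key k (ρ * rhoC φ (k + 1)) _ C₂ hγ
      (by rw [hw, epsC, Nat.add_sub_cancel]; ring) (h₂ d hd).1 (h₂ d hd).2
    rw [← hPsi] at b₁
    rw [← hPsi', abs_sub_comm] at b₂
    refine (abs_sub_le _ _ _).trans ((add_le_add b₁ b₂).trans ?_)
    rw [← add_div]
    exact div_le_div_of_nonneg_right (by linarith) (Real.sqrt_nonneg _)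

end
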